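/- (Combination of Theorems 1.3 and 1.4) There exists ε_0 > 0 such that for all ε ∈ (0, ε_0) and every triple (k, l, m) of linear maps k, l : U → V, m : W → V, the following are equivalent: (a) (k, l, m) is μ_{1+ε,1}-semistable; (b) (k, l, m) is μ_{1+ε,1}-stable; (c) (k, l, m) is a Strømme triple, i.e. x·k + y·l is injective for some (x,y) ∈ ℂ² and for every (x,y) ∈ ℂ² \ {(0,0)} the map U ⊕ W → V, (ζ, η) ↦ (x·k + y·l)(ζ) + m(η), is surjective. -/

import Mathlib

open LinearMap Module Submodule

noncomputable section

/-- The sum of the eigenspaces of `ξ` for (real) eigenvalues `≤ lam`. -/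
def eigFilt {E : Type*} [NormedAddCommGroup E] [InnerProductSpace ℂ E]
    (ξ : E →ₗ[ℂ] E) (lam : ℝ) : Submodule ℂ E :=
  ⨆ (μ : ℝ) (_ : μ ≤ lam), Module.End.eigenspace (ξ : Module.End ℂ E) (μ : ℂ)

variable {U V W : Type*}
  [NormedAddCommGroup U] [InnerProductSpace ℂ U] [FiniteDimensional ℂ U]
  [NormedAddCommGroup V] [InnerProductSpace ℂ V] [FiniteDimensional ℂ V]
  [NormedAddCommGroup W] [InnerProductSpace ℂ W] [FiniteDimensional ℂ W]

/-- The spectral condition on `((k,l,m), (ξ_U, ξ_V))`: `k(U_λ) ⊆ V_λ` and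
`l(U_λ) ⊆ V_λ` for all `λ ∈ ℝ`, and `range m ⊆ V_0`. -/
def TripleSpectralCond (k l : U →ₗ[ℂ] V) (m : W →ₗ[ℂ] V)
    (ξU : U →ₗ[ℂ] U) (ξV : V →ₗ[ℂ] V) : Prop :=
  (∀ lam : ℝ, (eigFilt ξU lam).map k ≤ eigFilt ξV lam) ∧
  (∀ lam : ℝ, (eigFilt ξU lam).map l ≤ eigFilt ξV lam) ∧
  LinearMap.range m ≤ eigFilt ξV 0

/-- `μ_{s,t}`-stability of a triple `(k,l,m)`. -/
def MuStableTriple (s t : ℝ) (k l : U →ₗ[ℂ] V) (m : W →ₗ[ℂ] V) : Prop :=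
  ∀ (ξU : U →ₗ[ℂ] U) (ξV : V →ₗ[ℂ] V), ξU.IsSymmetric → ξV.IsSymmetric →
    TripleSpectralCond k l m ξU ξV → ¬(ξU = 0 ∧ ξV = 0) →
    0 < t * (LinearMap.trace ℂ U ξU).re - s * (LinearMap.trace ℂ V ξV).re

/-- `μ_{s,t}`-semistability of a triple `(k,l,m)`. -/
def MuSemistableTriple (s t : ℝ) (k l : U →ₗ[ℂ] V) (m : W →ₗ[ℂ] V) : Prop :=
  ∀ (ξU : U →ₗ[ℂ] U) (ξV : V →ₗ[ℂ] V), ξU.IsSymmetric → ξV.IsSymmetric →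
    TripleSpectralCond k l m ξU ξV → ¬(ξU = 0 ∧ ξV = 0) →
    0 ≤ t * (LinearMap.trace ℂ U ξU).re - s * (LinearMap.trace ℂ V ξV).re

/-- `(k,l,m)` is a Strømme triple: `x·k + y·l` is injective for some `(x,y) ∈ ℂ²`, and
for every `(x,y) ≠ (0,0)` the map `U ⊕ W → V, (ζ,η) ↦ (x·k + y·l)(ζ) + m(η)` is
surjective. -/
def IsStrommeTriple (k l : U →ₗ[ℂ] V) (m : W →ₗ[ℂ] V) : Prop :=
  (∃ x y : ℂ, Function.Injective ⇑(x • k + y • l)) ∧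
  (∀ x y : ℂ, ¬(x = 0 ∧ y = 0) → Function.Surjective ⇑((x • k + y • l).coprod m))

section Helpers

open Filter Topology

/-- A vector in the range of all nearby pencil members lies in the range of a member of
maximal rank. -/
lemma mem_range_of_max_rank (φ ψ : U →ₗ[ℂ] V)
    (hmax : ∀ t : ℂ, finrank ℂ (range (φ + t • ψ)) ≤ finrank ℂ (range φ))
    (z : V) (hz : ∀ t : ℂ, t ≠ 0 → z ∈ range (φ + t • ψ)) : z ∈ range φ := by
  by_contra hcon
  let b := finBasis ℂ (range φ)
  have hc : ∀ i, ∃ c : U, φ c = (b i : V) := fun i => (b i).2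
  choose c hc using hc
  have hli : LinearIndependent ℂ (fun i => (b i : V)) :=
    b.linearIndependent.map' (range φ).subtype (by simp)
  have hspan : span ℂ (Set.range (fun i => (b i : V))) ≤ range φ := by
    rw [span_le]; rintro _ ⟨i, rfl⟩; exact (b i).2
  let g : ℂ → Option (Fin (finrank ℂ (range φ))) → V :=
    fun t o => Option.casesOn' o z (fun i => (φ + t • ψ) (c i))
  have h0 : LinearIndependent ℂ (g 0) := by
    have : (fun i => (φ + (0:ℂ) • ψ) (c i)) = (fun i => (b i : V)) := by
      ext i; simp [hc]
    simp only [g]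
    rw [this]
    exact hli.option (fun h => hcon (hspan h))
  have hg : Continuous g := by
    refine continuous_pi fun o => ?_
    cases o with
    | none => exact continuous_const
    | some i =>
      simp only [g, Option.casesOn'_some, LinearMap.add_apply, LinearMap.smul_apply]
      fun_prop
  have hev : ∀ᶠ t in 𝓝 (0:ℂ), LinearIndependent ℂ (g t) :=
    hg.continuousAt.eventually h0.eventually
  have hev2 : ∀ᶠ t in 𝓝[≠] (0:ℂ), LinearIndependent ℂ (g t) := hev.filter_mono nhdsWithin_le_nhds
  obtain ⟨t, ht, ht0⟩ := (hev2.and self_mem_nhdsWithin).exists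
  have hle : span ℂ (Set.range (g t)) ≤ range (φ + t • ψ) := by
    rw [span_le]; rintro _ ⟨o, rfl⟩
    cases o with
    | none => exact hz t ht0
    | some i => exact ⟨c i, rfl⟩
  have h1 := Submodule.finrank_mono hle
  rw [finrank_span_eq_card ht] at h1
  have := hmax t
  simp at h1
  omega

lemma exists_wong (φ ψ : U →ₗ[ℂ] V)
    (hmax : ∀ t : ℂ, finrank ℂ (range (φ + t • ψ)) ≤ finrank ℂ (range φ))
    (hφ : ¬ Function.Injective φ) :
    ∃ A : Submodule ℂ U, A.map ψ ≤ A.map φ ∧ finrank ℂ (A.map φ) < finrank ℂ A := by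
  let F : Submodule ℂ U →o Submodule ℂ U :=
    ⟨fun A => (A.map ψ).comap φ, fun A B h => comap_mono (map_mono h)⟩
  let A := F.lfp
  have hA : (A.map ψ).comap φ = A := F.map_lfp
  have hsub : A.map ψ ≤ range φ := by
    rintro _ ⟨x, hx, rfl⟩
    refine mem_range_of_max_rank φ ψ hmax _ fun t ht => ?_
    have : A ≤ (range (φ + t • ψ)).comap ψ := by
      refine F.lfp_le ?_
      rintro y ⟨x', hx', hy⟩
      have hx'' : φ y ∈ range (φ + t • ψ) := by
        rw [← hy]; exact hx'
      have h2 : t • ψ y ∈ range (φ + t • ψ) := by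
        have : t • ψ y = (φ + t • ψ) y - φ y := by simp
        rw [this]
        exact sub_mem ⟨y, rfl⟩ hx''
      have h3 := (range (φ + t • ψ)).smul_mem t⁻¹ h2
      rwa [inv_smul_smul₀ ht] at h3
    exact this hx
  have hker : ker φ ≤ A := by
    rw [← hA]
    intro x hx
    have hx0 : φ x = 0 := hx
    rw [Submodule.mem_comap, hx0]
    exact zero_mem _
  refine ⟨A, ?_, ?_⟩
  · rintro z hz
    obtain ⟨x, rfl⟩ := hsub hz
    exact ⟨x, by rw [← hA]; exact hz, rfl⟩
  · have h1 := LinearMap.finrank_range_add_finrank_ker (φ.domRestrict A)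
    rw [LinearMap.range_domRestrict] at h1
    have : 0 < finrank ℂ (ker (φ.domRestrict A)) := by
      rw [Module.finrank_pos_iff, Submodule.nontrivial_iff_ne_bot]
      intro hb
      rw [injective_iff_map_eq_zero] at hφ
      push Not at hφ
      obtain ⟨x, hx, hx0⟩ := hφ
      have : (⟨x, hker hx⟩ : A) ∈ ker (φ.domRestrict A) := by
        simpa using hx
      rw [hb] at this
      simp at this
      exact hx0 this
    omega

lemma exists_injective_of_dim (k l : U →ₗ[ℂ] V)
    (h : ∀ (A : Submodule ℂ U) (B : Submodule ℂ V), A.map k ≤ B → A.map l ≤ B →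
      finrank ℂ A ≤ finrank ℂ B) :
    ∃ x y : ℂ, Function.Injective ⇑(x • k + y • l) := by
  by_contra hno
  push Not at hno
  let P := {p : ℂ × ℂ // p ≠ 0}
  let R : P → ℕ := fun p => finrank ℂ (range (p.1.1 • k + p.1.2 • l))
  have hbd : ∃ p : P, ∀ q, R q ≤ R p := by
    have hne : (Set.range R).Nonempty := ⟨_, ⟨⟨(1,0), by simp⟩, rfl⟩⟩
    have hb : BddAbove (Set.range R) := ⟨finrank ℂ V, by
      rintro _ ⟨p, rfl⟩; exact Submodule.finrank_le _⟩
    obtain ⟨p, hp⟩ := Nat.sSup_mem hne hb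
    exact ⟨p, fun q => hp ▸ le_csSup hb ⟨q, rfl⟩⟩
  obtain ⟨⟨⟨x, y⟩, hp⟩, hmax⟩ := hbd
  have key : ∀ ψ : U →ₗ[ℂ] V, (∀ t : ℂ, ∃ q : P, x • k + y • l + t • ψ = q.1.1 • k + q.1.2 • l) →
      (∃ a b : ℂ, k = a • (x • k + y • l) + b • ψ) → (∃ a b : ℂ, l = a • (x • k + y • l) + b • ψ) →
      False := by
    intro ψ h1 ⟨a, b, hk⟩ ⟨a', b', hl⟩
    obtain ⟨A, hA1, hA2⟩ := exists_wong (x • k + y • l) ψ (fun t => by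
      obtain ⟨q, hq⟩ := h1 t
      rw [hq]; exact hmax q) (hno x y)
    have aux : ∀ (a b : ℂ) (f : U →ₗ[ℂ] V), f = a • (x • k + y • l) + b • ψ →
        A.map f ≤ A.map (x • k + y • l) := by
      rintro a b f hf _ ⟨z, hz, rfl⟩
      rw [hf]
      exact add_mem (smul_mem _ _ ⟨z, hz, rfl⟩) (smul_mem _ _ (hA1 ⟨z, hz, rfl⟩))
    have := h A _ (aux a b k hk) (aux a' b' l hl)
    omega
  by_cases hx : x = 0
  · have hy : y ≠ 0 := by
      rintro rfl; exact hp (by simp [hx])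
    refine key k (fun t => ⟨⟨(x + t, y), by simp [hy]⟩, by simp only; module⟩) ⟨0, 1, by simp⟩
      ⟨y⁻¹, 0, ?_⟩
    simp [hx, smul_smul, hy]
  · refine key l (fun t => ⟨⟨(x, y + t), by simp [hx]⟩, by simp only; module⟩)
      ⟨x⁻¹, -(x⁻¹ * y), ?_⟩ ⟨0, 1, by simp⟩
    rw [smul_add, smul_smul, smul_smul, inv_mul_cancel₀ hx]
    module

/-- The subspace form of stability. -/
def SubCond (k l : U →ₗ[ℂ] V) (m : W →ₗ[ℂ] V) : Prop :=
  (∀ (A : Submodule ℂ U) (B : Submodule ℂ V), A.map k ≤ B → A.map l ≤ B →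
      finrank ℂ A ≤ finrank ℂ B) ∧
  (∀ (A : Submodule ℂ U) (B : Submodule ℂ V), A.map k ≤ B → A.map l ≤ B → range m ≤ B →
      B ≠ ⊤ → finrank ℂ V + finrank ℂ A < finrank ℂ U + finrank ℂ B)

lemma SubCond.stromme {k l : U →ₗ[ℂ] V} {m : W →ₗ[ℂ] V} (h : SubCond k l m) :
    IsStrommeTriple k l m := by
  refine ⟨exists_injective_of_dim k l h.1, fun x y hxy => ?_⟩
  rw [← LinearMap.range_eq_top]
  by_contra hne
  obtain ⟨f, hf0, hf⟩ := Submodule.exists_le_ker_of_lt_top _ (lt_top_iff_ne_top.2 hne)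
  have hfp : ∀ z, x * f (k z) + y * f (l z) = 0 := fun z => by
    have := hf ⟨(z, 0), rfl⟩
    simpa using this
  have hfm : range m ≤ ker f := by
    rintro _ ⟨w, rfl⟩
    have := hf ⟨(0, w), rfl⟩
    simpa using this
  have hB : finrank ℂ (ker f) + 1 = finrank ℂ V :=
    Module.Dual.finrank_ker_add_one_of_ne_zero hf0
  have main : ∀ g : U →ₗ[ℂ] ℂ, (∀ z, g z = 0 → f (k z) = 0 ∧ f (l z) = 0) → False := by
    intro g hg
    have h1 := h.2 (ker g) (ker f) (by rintro _ ⟨z, hz, rfl⟩; exact (hg z hz).1)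
      (by rintro _ ⟨z, hz, rfl⟩; exact (hg z hz).2) hfm (by
        intro ht; exact hf0 (LinearMap.ker_eq_top.1 ht))
    have h2 := LinearMap.finrank_range_add_finrank_ker g
    have h3 : finrank ℂ (range g) ≤ 1 := by
      simpa using Submodule.finrank_le (range g)
    omega
  by_cases hx : x = 0
  · have hy : y ≠ 0 := fun hy => hxy ⟨hx, hy⟩
    refine main (f ∘ₗ k) fun z hz => ⟨hz, ?_⟩
    have := hfp z
    simpa [hx, hy] using this
  · refine main (f ∘ₗ l) fun z hz => ⟨?_, hz⟩
    have := hfp z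
    have hz' : f (l z) = 0 := hz
    simpa [hx, hz'] using this

lemma IsStrommeTriple.subCond {k l : U →ₗ[ℂ] V} {m : W →ₗ[ℂ] V} (h : IsStrommeTriple k l m) :
    SubCond k l m := by
  obtain ⟨⟨x, y, hinj⟩, hsurj⟩ := h
  refine ⟨fun A B hk hl => ?_, fun A B hk hl hm hB => ?_⟩
  · have h1 : finrank ℂ (A.map (x • k + y • l)) = finrank ℂ A :=
      (LinearEquiv.finrank_eq (Submodule.equivMapOfInjective _ hinj A)).symm
    rw [← h1]
    refine Submodule.finrank_mono ?_
    rintro _ ⟨z, hz, rfl⟩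
    exact add_mem (smul_mem _ _ (hk ⟨z, hz, rfl⟩)) (smul_mem _ _ (hl ⟨z, hz, rfl⟩))
  · let k' := A.mapQ B k (map_le_iff_le_comap.1 hk)
    let l' := A.mapQ B l (map_le_iff_le_comap.1 hl)
    have hs : ∀ x y : ℂ, ¬ (x = 0 ∧ y = 0) → Function.Surjective (x • k' + y • l') := by
      intro x y hxy q
      obtain ⟨v, rfl⟩ := B.mkQ_surjective q
      obtain ⟨⟨z, w⟩, hzw⟩ := hsurj x y hxy v
      refine ⟨A.mkQ z, ?_⟩
      have hw : B.mkQ (m w) = 0 := by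
        simpa using hm ⟨w, rfl⟩
      rw [← hzw]
      simp only [LinearMap.coprod_apply, map_add, hw, add_zero]
      simp [k', l']
    have e1 := A.finrank_quotient_add_finrank
    have e2 := B.finrank_quotient_add_finrank
    have hle : finrank ℂ (V ⧸ B) ≤ finrank ℂ (U ⧸ A) :=
      LinearMap.finrank_le_finrank_of_surjective (hs 1 0 (by simp))
    rcases hle.lt_or_eq with hlt | heq
    · omega
    exfalso
    have hnt : Nontrivial (V ⧸ B) := Submodule.Quotient.nontrivial_iff.2 hB
    have hl's : Function.Surjective l' := by simpa using hs 0 1 (by simp)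
    have hl'i : Function.Injective l' :=
      (LinearMap.injective_iff_surjective_of_finrank_eq_finrank heq.symm).2 hl's
    let L := LinearEquiv.ofBijective l' ⟨hl'i, hl's⟩
    obtain ⟨c, hc⟩ := Module.End.exists_eigenvalue (K := ℂ) (V := V ⧸ B) (k' ∘ₗ L.symm.toLinearMap)
    obtain ⟨q, hq⟩ := hc.exists_hasEigenvector
    have hq1 := hq.apply_eq_smul
    have hinj' : Function.Injective ((1:ℂ) • k' + (-c) • l') :=
      (LinearMap.injective_iff_surjective_of_finrank_eq_finrank heq.symm).2 (hs 1 (-c) (by simp))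
    have h0 : ((1:ℂ) • k' + (-c) • l') (L.symm q) = 0 := by
      have hLq : l' (L.symm q) = q := L.apply_symm_apply q
      have : k' (L.symm q) = c • q := hq1
      simp [this, hLq]
    have : L.symm q = 0 := hinj' (by rw [h0, map_zero])
    exact hq.2 (by simpa using this)

section TwoStep

variable {E : Type*} [NormedAddCommGroup E] [InnerProductSpace ℂ E] [FiniteDimensional ℂ E]

/-- The self-adjoint map with eigenvalue `a` on `A` and `a + 1` on its complement. -/
def twoStep (a : ℝ) (A : Submodule ℂ E) : E →ₗ[ℂ] E :=
  ((a + 1 : ℝ) : ℂ) • LinearMap.id - (A.starProjection : E →ₗ[ℂ] E)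

lemma twoStep_symm (a : ℝ) (A : Submodule ℂ E) : (twoStep a A).IsSymmetric := by
  refine LinearMap.IsSymmetric.sub ?_ A.starProjection_isSymmetric
  intro x y
  simp [inner_smul_left, inner_smul_right]

lemma twoStep_trace (a : ℝ) (A : Submodule ℂ E) :
    (LinearMap.trace ℂ E (twoStep a A)).re = (a + 1) * finrank ℂ E - finrank ℂ A := by
  have hp : LinearMap.IsProj A (A.starProjection : E →ₗ[ℂ] E) :=
    ⟨fun x => A.starProjection_apply_mem x, fun x hx => starProjection_eq_self_iff.2 hx⟩
  simp only [twoStep, map_sub, map_smul, hp.trace, LinearMap.trace_id]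
  simp

lemma twoStep_ne_zero (a : ℝ) (A : Submodule ℂ E) (x : E) (h : twoStep a A = 0) :
    ((a + 1 : ℝ) : ℂ) • x = A.starProjection x := by
  have := LinearMap.congr_fun h x
  simpa [twoStep, sub_eq_zero] using this

lemma mem_eigFilt_of {ξ : E →ₗ[ℂ] E} {x : E} {μ lam : ℝ} (h : μ ≤ lam)
    (hx : ξ x = (μ : ℂ) • x) : x ∈ eigFilt ξ lam := by
  unfold eigFilt
  exact (le_iSup₂_of_le (f := fun (μ : ℝ) (_ : μ ≤ lam) => Module.End.eigenspace ξ (μ:ℂ)) μ h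
    le_rfl) (Module.End.mem_eigenspace_iff.2 hx)

lemma eigFilt_le {ξ : E →ₗ[ℂ] E} {lam : ℝ} {S : Submodule ℂ E}
    (h : ∀ (μ : ℝ) (x : E), μ ≤ lam → ξ x = (μ : ℂ) • x → x ∈ S) : eigFilt ξ lam ≤ S :=
  iSup₂_le fun μ hμ x hx => h μ x hμ (Module.End.mem_eigenspace_iff.1 hx)

lemma twoStep_le (a : ℝ) (A : Submodule ℂ E) {lam : ℝ} (h : a ≤ lam) :
    A ≤ eigFilt (twoStep a A) lam := by
  intro x hx
  refine mem_eigFilt_of h ?_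
  simp [twoStep, starProjection_eq_self_iff.2 hx, add_smul]

lemma twoStep_top (a : ℝ) (A : Submodule ℂ E) {lam : ℝ} (h : a + 1 ≤ lam) :
    eigFilt (twoStep a A) lam = ⊤ := by
  rw [eq_top_iff]
  intro x _
  have h1 : A.starProjection x ∈ eigFilt (twoStep a A) lam :=
    twoStep_le a A (by linarith) (A.starProjection_apply_mem x)
  have h2 : x - A.starProjection x ∈ eigFilt (twoStep a A) lam := by
    refine mem_eigFilt_of h ?_
    have : A.starProjection (A.starProjection x) = A.starProjection x :=
      starProjection_eq_self_iff.2 (A.starProjection_apply_mem x)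
    simp [twoStep, this]
  simpa using add_mem h1 h2

lemma twoStep_eig {a : ℝ} {A : Submodule ℂ E} {μ : ℝ} {x : E}
    (hx : twoStep a A x = (μ : ℂ) • x) : (μ = a ∨ A.starProjection x = 0) ∧ (μ = a + 1 ∨ x ∈ A) := by
  have h1 : ((a + 1 : ℝ) : ℂ) • x - A.starProjection x = (μ:ℂ) • x := by
    simpa [twoStep] using hx
  have hpp : A.starProjection (A.starProjection x) = A.starProjection x :=
      starProjection_eq_self_iff.2 (A.starProjection_apply_mem x)
  have h2 := congrArg A.starProjection h1
  rw [map_sub, map_smul, map_smul, hpp] at h2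
  constructor
  · have : ((a : ℂ) - μ) • A.starProjection x = 0 := by
      have h3 := sub_eq_zero.2 h2
      rw [← h3]; push_cast; module
    rcases smul_eq_zero.1 this with h | h
    · left; exact_mod_cast (sub_eq_zero.1 h).symm
    · exact Or.inr h
  · by_cases hμ : μ = a + 1
    · exact Or.inl hμ
    right
    have h3 : A.starProjection x = ((a + 1 - μ : ℝ) : ℂ) • x := by
      have : A.starProjection x = ((a + 1 : ℝ) : ℂ) • x - (μ:ℂ) • x := by rw [← h1]; abel
      rw [this]; push_cast; module
    have hne : ((a + 1 - μ : ℝ) : ℂ) ≠ 0 := by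
      norm_cast; intro h; exact hμ (by linarith)
    have : x = ((a + 1 - μ : ℝ) : ℂ)⁻¹ • A.starProjection x := by
      rw [h3, inv_smul_smul₀ hne]
    rw [this]
    exact smul_mem _ _ (A.starProjection_apply_mem x)

lemma twoStep_mid (a : ℝ) (A : Submodule ℂ E) {lam : ℝ} (h : lam < a + 1) :
    eigFilt (twoStep a A) lam ≤ A := by
  refine eigFilt_le fun μ x hμ hx => ?_
  exact (twoStep_eig hx).2.resolve_left (by intro h; linarith)

lemma twoStep_bot (a : ℝ) (A : Submodule ℂ E) {lam : ℝ} (h : lam < a) :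
    eigFilt (twoStep a A) lam ≤ ⊥ := by
  refine eigFilt_le fun μ x hμ hx => ?_
  have h1 := (twoStep_eig hx).2.resolve_left (by intro h; linarith)
  have h2 := (twoStep_eig hx).1.resolve_left (by intro h; linarith)
  rw [starProjection_eq_self_iff.2 h1] at h2
  simpa using h2

end TwoStep

lemma twoStep_map (a : ℝ) {k : U →ₗ[ℂ] V} {A : Submodule ℂ U} {B : Submodule ℂ V}
    (h : A.map k ≤ B) (lam : ℝ) :
    (eigFilt (twoStep a A) lam).map k ≤ eigFilt (twoStep a B) lam := by
  rcases lt_or_ge lam a with h1 | h1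
  · refine (Submodule.map_mono (twoStep_bot a A h1)).trans ?_
    simp
  rcases lt_or_ge lam (a + 1) with h2 | h2
  · exact ((Submodule.map_mono (twoStep_mid a A h2)).trans h).trans (twoStep_le a B h1)
  · rw [twoStep_top a B h2]; exact le_top

lemma MuSemistableTriple.subCond {ε : ℝ} (hε : 0 < ε) (hε1 : ε * finrank ℂ V < 1)
    {k l : U →ₗ[ℂ] V} {m : W →ₗ[ℂ] V} (h : MuSemistableTriple (1 + ε) 1 k l m) :
    SubCond k l m := by
  refine ⟨fun A B hk hl => ?_, fun A B hk hl hm hB => ?_⟩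
  · by_contra hlt
    push Not at hlt
    have := h (twoStep (-1) A) (twoStep (-1) B) (twoStep_symm _ _) (twoStep_symm _ _)
      ⟨twoStep_map _ hk, twoStep_map _ hl, by rw [twoStep_top (-1) B (by norm_num)]; exact le_top⟩
      (by
        rintro ⟨h1, -⟩
        have hA : A = ⊥ := by
          rw [eq_bot_iff]
          intro x hx
          have := twoStep_ne_zero (-1) A x h1
          rw [starProjection_eq_self_iff.2 hx] at this
          simpa using this.symm
        rw [hA] at hlt
        simp at hlt)
    rw [twoStep_trace, twoStep_trace] at this
    have hBV : (finrank ℂ B : ℝ) ≤ finrank ℂ V := by exact_mod_cast Submodule.finrank_le B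
    have hlt' : (finrank ℂ B : ℝ) + 1 ≤ finrank ℂ A := by exact_mod_cast hlt
    nlinarith [mul_le_mul_of_nonneg_left hBV hε.le]
  · have := h (twoStep 0 A) (twoStep 0 B) (twoStep_symm _ _) (twoStep_symm _ _)
      ⟨twoStep_map _ hk, twoStep_map _ hl, hm.trans (twoStep_le 0 B le_rfl)⟩
      (by
        rintro ⟨-, h1⟩
        apply hB
        rw [eq_top_iff]
        intro x _
        have := twoStep_ne_zero 0 B x h1
        simp only [zero_add, Complex.ofReal_one, one_smul] at this
        rw [this]
        exact B.starProjection_apply_mem x)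
    rw [twoStep_trace, twoStep_trace] at this
    have hlt : finrank ℂ B < finrank ℂ V := Submodule.finrank_lt hB
    have hlt' : (finrank ℂ B : ℝ) + 1 ≤ finrank ℂ V := by exact_mod_cast hlt
    have : (finrank ℂ V + finrank ℂ A : ℝ) < finrank ℂ U + finrank ℂ B := by nlinarith
    exact_mod_cast this

section Eig

variable {E : Type*} [NormedAddCommGroup E] [InnerProductSpace ℂ E] [FiniteDimensional ℂ E]

lemma finrank_eigFilt {ξ : E →ₗ[ℂ] E} (hξ : ξ.IsSymmetric) (lam : ℝ) :
    finrank ℂ (eigFilt ξ lam) =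
      (Finset.univ.filter fun i => hξ.eigenvalues rfl i ≤ lam).card := by
  let b := hξ.eigenvectorBasis rfl
  have hspan : eigFilt ξ lam =
      span ℂ (Set.range fun i : {i // hξ.eigenvalues rfl i ≤ lam} => b i) := by
    apply le_antisymm
    · refine eigFilt_le fun μ x hμ hx => ?_
      rw [← b.sum_repr x]
      refine sum_mem fun i _ => ?_
      by_cases hi : hξ.eigenvalues rfl i ≤ lam
      · exact smul_mem _ _ (subset_span ⟨⟨i, hi⟩, rfl⟩)
      · have h1 : b.repr (ξ x) i = hξ.eigenvalues rfl i * b.repr x i :=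
          hξ.eigenvectorBasis_apply_self_apply rfl x i
        rw [hx] at h1
        simp only [map_smul, PiLp.smul_apply, smul_eq_mul] at h1
        have h2 : b.repr x i = 0 := by
          by_contra hne
          have := mul_right_cancel₀ hne h1
          have : μ = hξ.eigenvalues rfl i := Complex.ofReal_injective this
          exact hi (this ▸ hμ)
        rw [h2, zero_smul]; exact zero_mem _
    · rw [span_le]
      rintro _ ⟨i, rfl⟩
      exact mem_eigFilt_of i.2 (hξ.apply_eigenvectorBasis rfl i)
  have hli : LinearIndependent ℂ (fun i : {i // hξ.eigenvalues rfl i ≤ lam} => b i) :=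
    b.orthonormal.linearIndependent.comp _ Subtype.val_injective
  rw [hspan, finrank_span_eq_card hli, Fintype.card_subtype]

lemma eq_zero_of_eigenvalues {ξ : E →ₗ[ℂ] E} (hξ : ξ.IsSymmetric)
    (h : ∀ i, hξ.eigenvalues rfl i = 0) : ξ = 0 := by
  refine (hξ.eigenvectorBasis rfl).toBasis.ext fun i => ?_
  simp [hξ.apply_eigenvectorBasis rfl i, h i]

end Eig

open MeasureTheory in
lemma layer_lt {n : ℕ} (e : Fin n → ℝ) :
    IntegrableOn (fun t : ℝ => ((Finset.univ.filter fun i => t < e i).card : ℝ)) (Set.Ioi 0) ∧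
    ∫ t in Set.Ioi (0:ℝ), ((Finset.univ.filter fun i => t < e i).card : ℝ) = ∑ i, max (e i) 0 := by
  have h1 : (fun t : ℝ => ((Finset.univ.filter fun i => t < e i).card : ℝ)) =
      fun t => ∑ i, (Set.Iio (e i)).indicator (fun _ => (1:ℝ)) t := by
    ext t
    simp [Set.indicator_apply]
  have h2 : ∀ i, IntegrableOn ((Set.Iio (e i)).indicator (fun _ => (1:ℝ))) (Set.Ioi 0) := by
    intro i
    rw [IntegrableOn, integrable_indicator_iff measurableSet_Iio, IntegrableOn,
      Measure.restrict_restrict measurableSet_Iio, Set.Iio_inter_Ioi]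
    simp
  rw [h1]
  refine ⟨integrable_finsetSum _ fun i _ => h2 i, ?_⟩
  rw [integral_finsetSum _ fun i _ => h2 i]
  refine Finset.sum_congr rfl fun i _ => ?_
  rw [integral_indicator measurableSet_Iio, Measure.restrict_restrict measurableSet_Iio,
    Set.Iio_inter_Ioi]
  simp [Measure.real, ENNReal.toReal_ofReal']

open MeasureTheory in
lemma layer_le {n : ℕ} (e : Fin n → ℝ) :
    IntegrableOn (fun t : ℝ => ((Finset.univ.filter fun i => t ≤ e i).card : ℝ)) (Set.Ioi 0) ∧
    ∫ t in Set.Ioi (0:ℝ), ((Finset.univ.filter fun i => t ≤ e i).card : ℝ) = ∑ i, max (e i) 0 := by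
  have h1 : (fun t : ℝ => ((Finset.univ.filter fun i => t ≤ e i).card : ℝ)) =
      fun t => ∑ i, (Set.Iic (e i)).indicator (fun _ => (1:ℝ)) t := by
    ext t
    simp [Set.indicator_apply]
  have h2 : ∀ i, IntegrableOn ((Set.Iic (e i)).indicator (fun _ => (1:ℝ))) (Set.Ioi 0) := by
    intro i
    rw [IntegrableOn, integrable_indicator_iff measurableSet_Iic, IntegrableOn,
      Measure.restrict_restrict measurableSet_Iic, Set.inter_comm, Set.Ioi_inter_Iic]
    simp
  rw [h1]
  refine ⟨integrable_finsetSum _ fun i _ => h2 i, ?_⟩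
  rw [integral_finsetSum _ fun i _ => h2 i]
  refine Finset.sum_congr rfl fun i _ => ?_
  rw [integral_indicator measurableSet_Iic, Measure.restrict_restrict measurableSet_Iic,
    Set.inter_comm, Set.Ioi_inter_Iic]
  simp [Measure.real, ENNReal.toReal_ofReal']

open MeasureTheory in
lemma layer_lt_mono {n n' : ℕ} (e : Fin n → ℝ) (f : Fin n' → ℝ) (p q : ℝ)
    (h : ∀ t : ℝ, 0 < t → q * ((Finset.univ.filter fun i => t < f i).card : ℝ) ≤
      p * ((Finset.univ.filter fun i => t < e i).card : ℝ)) :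
    q * ∑ i, max (f i) 0 ≤ p * ∑ i, max (e i) 0 := by
  rw [← (layer_lt e).2, ← (layer_lt f).2, ← integral_const_mul, ← integral_const_mul]
  exact setIntegral_mono_on ((layer_lt f).1.const_mul q) ((layer_lt e).1.const_mul p)
    measurableSet_Ioi fun t ht => h t ht

open MeasureTheory in
lemma layer_le_mono {n n' : ℕ} (e : Fin n → ℝ) (f : Fin n' → ℝ) (p q : ℝ)
    (h : ∀ t : ℝ, 0 < t → q * ((Finset.univ.filter fun i => t ≤ f i).card : ℝ) ≤
      p * ((Finset.univ.filter fun i => t ≤ e i).card : ℝ)) :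
    q * ∑ i, max (f i) 0 ≤ p * ∑ i, max (e i) 0 := by
  rw [← (layer_le e).2, ← (layer_le f).2, ← integral_const_mul, ← integral_const_mul]
  exact setIntegral_mono_on ((layer_le f).1.const_mul q) ((layer_le e).1.const_mul p)
    measurableSet_Ioi fun t ht => h t ht

lemma card_gt {n : ℕ} (e : Fin n → ℝ) (t : ℝ) :
    ((Finset.univ.filter fun i => t < e i).card : ℝ) =
      n - ((Finset.univ.filter fun i => e i ≤ t).card : ℝ) := by
  have := Finset.card_filter_add_card_filter_not (s := (Finset.univ : Finset (Fin n)))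
    (fun i => e i ≤ t)
  simp only [not_le, Finset.card_univ, Fintype.card_fin] at this
  rw [eq_sub_iff_add_eq, add_comm]
  exact_mod_cast this

lemma eigFilt_mono {E : Type*} [NormedAddCommGroup E] [InnerProductSpace ℂ E] 
    (ξ : E →ₗ[ℂ] E) {a b : ℝ} (h : a ≤ b) : eigFilt ξ a ≤ eigFilt ξ b :=
  iSup₂_le fun μ hμ => le_iSup₂_of_le
    (f := fun (μ : ℝ) (_ : μ ≤ b) => Module.End.eigenspace ξ (μ:ℂ)) μ (hμ.trans h) le_rfl

lemma SubCond.stable {ε : ℝ} (hε : 0 < ε) (hε1 : ε * (4 * (finrank ℂ V + 1)) < 1)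
    {k l : U →ₗ[ℂ] V} {m : W →ₗ[ℂ] V} (h : SubCond k l m) :
    MuStableTriple (1 + ε) 1 k l m := by
  intro ξU ξV hU hV ⟨hk, hl, hm⟩ hne
  have tU : (LinearMap.trace ℂ U ξU).re = ∑ i, hU.eigenvalues rfl i :=
    hU.re_trace_eq_sum_eigenvalues rfl
  have tV : (LinearMap.trace ℂ V ξV).re = ∑ i, hV.eigenvalues rfl i :=
    hV.re_trace_eq_sum_eigenvalues rfl
  have hu := fun lam => finrank_eigFilt hU lam
  have hv := fun lam => finrank_eigFilt hV lam
  have hUz := eq_zero_of_eigenvalues hU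
  have hVz := eq_zero_of_eigenvalues hV
  rw [tU, tV]
  generalize hU.eigenvalues rfl = e at *
  generalize hV.eigenvalues rfl = f at *
  have hV0 : (0:ℝ) ≤ finrank ℂ V := Nat.cast_nonneg _
  have hε2 : ε < 1 / 4 := by nlinarith
  have pos : (1 + ε + ε / 2) * ∑ i, max (f i) 0 ≤ (1 - ε / 2) * ∑ i, max (e i) 0 := by
    refine layer_lt_mono e f _ _ fun t ht => ?_
    rw [card_gt, card_gt, ← hu, ← hv]
    have ha : (finrank ℂ (eigFilt ξU t) : ℝ) ≤ finrank ℂ U := by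
      exact_mod_cast Submodule.finrank_le _
    by_cases htop : eigFilt ξV t = ⊤
    · rw [htop, finrank_top, sub_self, mul_zero]
      exact mul_nonneg (by linarith) (by linarith)
    · have h2 := h.2 _ _ (hk t) (hl t) (hm.trans (eigFilt_mono ξV ht.le)) htop
      have h2' : (finrank ℂ V : ℝ) + finrank ℂ (eigFilt ξU t) + 1 ≤
        finrank ℂ U + finrank ℂ (eigFilt ξV t) := by exact_mod_cast h2
      have hb0 : (0:ℝ) ≤ finrank ℂ (eigFilt ξV t) := Nat.cast_nonneg _
      have h3 : (1 - ε / 2) * (finrank ℂ V - finrank ℂ (eigFilt ξV t) + 1 : ℝ) ≤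
          (1 - ε / 2) * (finrank ℂ U - finrank ℂ (eigFilt ξU t)) :=
        mul_le_mul_of_nonneg_left (by linarith) (by linarith)
      nlinarith [mul_nonneg hε.le hb0]
  have neg : (1 + ε / 2) * ∑ i, max (-e i) 0 ≤ (1 + ε - ε / 2) * ∑ i, max (-f i) 0 := by
    refine layer_le_mono (fun i => -f i) (fun i => -e i) _ _ fun t ht => ?_
    have h1 := h.1 _ _ (hk (-t)) (hl (-t))
    rw [hu, hv] at h1
    simp only [le_neg (a := t)]
    have h1' : ((Finset.univ.filter fun i => e i ≤ -t).card : ℝ) ≤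
      ((Finset.univ.filter fun i => f i ≤ -t).card : ℝ) := by exact_mod_cast h1
    nlinarith
  have dec : ∀ {n : ℕ} (g : Fin n → ℝ), ∑ i, g i = ∑ i, max (g i) 0 - ∑ i, max (-g i) 0 := by
    intro n g
    rw [← Finset.sum_sub_distrib]
    refine Finset.sum_congr rfl fun i _ => ?_
    rcases le_total (g i) 0 with h | h
    · rw [max_eq_right h, max_eq_left (by linarith)]; ring
    · rw [max_eq_left h, max_eq_right (by linarith)]; ring
  have nn : ∀ {n : ℕ} (g : Fin n → ℝ), 0 ≤ ∑ i, max (g i) 0 :=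
    fun g => Finset.sum_nonneg fun i _ => le_max_right _ _
  have zz : ∀ {n : ℕ} (g : Fin n → ℝ), ∑ i, max (g i) 0 = 0 → ∀ i, g i ≤ 0 := by
    intro n g hg i
    have := (Finset.sum_eq_zero_iff_of_nonneg (fun i _ => le_max_right (g i) 0)).1 hg i
      (Finset.mem_univ i)
    exact max_eq_right_iff.1 this
  rw [dec e, dec f]
  have n1 := nn e
  have n2 := nn f
  have n3 := nn (fun i => -e i)
  have n4 := nn (fun i => -f i)
  by_contra hcon
  have hs : ε / 2 * (∑ i, max (e i) 0 + ∑ i, max (f i) 0 + ∑ i, max (-e i) 0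
    + ∑ i, max (-f i) 0) ≤ 0 := by nlinarith
  have hs' := nonpos_of_mul_nonpos_right hs (by linarith)
  apply hne
  constructor
  · refine hUz fun i => le_antisymm (zz e (by linarith) i) ?_
    have := zz (fun i => -e i) (by linarith) i
    linarith
  · refine hVz fun i => le_antisymm (zz f (by linarith) i) ?_
    have := zz (fun i => -f i) (by linarith) i
    linarith

end Helpers

/-- **combination of Theorems 1.3 and 1.4.** There is `ε₀ > 0` so that
for all `ε ∈ (0, ε₀)` and every triple `(k, l, m)`: `(k,l,m)` is
`μ_{1+ε,1}`-semistable iff it is `μ_{1+ε,1}`-stable iff it is a Strømme triple. -/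
theorem muStable_iff_stromme (r : ℕ)
    (hdim : finrank ℂ V = finrank ℂ U + r) (hrw : r ≤ finrank ℂ W) :
    ∃ ε₀ : ℝ, 0 < ε₀ ∧ ∀ ε : ℝ, 0 < ε → ε < ε₀ →
      ∀ (k l : U →ₗ[ℂ] V) (m : W →ₗ[ℂ] V),
        (MuSemistableTriple (1 + ε) 1 k l m ↔ MuStableTriple (1 + ε) 1 k l m) ∧
        (MuStableTriple (1 + ε) 1 k l m ↔ IsStrommeTriple k l m) := by
  have hV : (0:ℝ) ≤ finrank ℂ V := Nat.cast_nonneg _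
  refine ⟨1 / (4 * (finrank ℂ V + 1)), by positivity, fun ε hε hε0 k l m => ?_⟩
  have h1 : ε * (4 * (finrank ℂ V + 1)) < 1 := by
    rwa [lt_div_iff₀ (by positivity)] at hε0
  have h2 : ε * finrank ℂ V < 1 := by nlinarith [mul_nonneg hε.le hV]
  have hss : MuStableTriple (1 + ε) 1 k l m → MuSemistableTriple (1 + ε) 1 k l m :=
    fun h a b c d e f => (h a b c d e f).le
  exact ⟨⟨fun h => (h.subCond hε h2).stable hε h1, hss⟩,
    ⟨fun h => ((hss h).subCond hε h2).stromme, fun h => h.subCond.stable hε h1⟩⟩
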